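/- Let q be a prime power, Q = q², m ≥ 2 an even integer, m̄ = m/2, n = Q^m − 1, e a divisor of q + 1, n̂ = n/e, and let 2 ≤ δ ≤ Q^m̄ + 1 = q^m + 1. Let α be a generator of GF(Q^m)*, m_i(x) the minimal polynomial of α^i over GF(Q) (indices modulo n), and let C be the cyclic code of length n over GF(Q) with generator polynomial g(x) = (x − α^{n̂}) · g_{(n,δ,n̂+1)}(x) · lcm(m_{n̂−q(δ−1)}(x), m_{n̂−q(δ−2)}(x), …, m_{n̂−q}(x)). Then C is a Hermitian LCD code over GF(Q) of length n = Q^m − 1, dimension k = Q^m − 2 − 2(δ − 1 − ⌊(δ−1)/Q⌋)m, and minimum distance d ≥ δ + 1 + ⌊(δ−1)/q⌋. -/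

import Mathlib

open Polynomial

noncomputable section

/-- The cyclic shift of a vector: `(c₀,…,c_{n−1}) ↦ (c_{n−1},c₀,…,c_{n−2})`. -/
def cyclicShift {F : Type*} {n : ℕ} (c : Fin n → F) : Fin n → F :=
  fun i => c ⟨(i.val + (n - 1)) % n, Nat.mod_lt _ i.pos⟩

/-- A linear code (submodule of `F^n`) is cyclic if it is stable under the cyclic shift. -/
def IsCyclicCode {F : Type*} [Field F] {n : ℕ} (C : Submodule F (Fin n → F)) : Prop :=
  ∀ c ∈ C, cyclicShift c ∈ C

/-- The Hermitian dual `C^⊥H = {b : ∑ i, b i * (c i)^q = 0 for all c ∈ C}`. -/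
def hermDualSet {F : Type*} [Field F] (q : ℕ) {n : ℕ} (C : Set (Fin n → F)) :
    Set (Fin n → F) :=
  {b | ∀ c ∈ C, ∑ i, b i * (c i) ^ q = 0}

/-- A code is Hermitian LCD if `C ∩ C^⊥H = {0}`. -/
def IsHermitianLCD {F : Type*} [Field F] (q : ℕ) {n : ℕ} (C : Set (Fin n → F)) : Prop :=
  C ∩ hermDualSet q C = {0}

/-- The polynomial `c₀ + c₁ x + ⋯ + c_{n−1} x^{n−1}` associated with a vector. -/
def polyOfVec {F : Type*} [Field F] {n : ℕ} (c : Fin n → F) : Polynomial F :=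
  ∑ i : Fin n, Polynomial.C (c i) * Polynomial.X ^ (i : ℕ)

/-- The cyclic code of length `n` with generator polynomial `g` (for `g ∣ xⁿ − 1`):
vectors whose associated polynomial (of degree `< n`) is divisible by `g`. -/
def cyclicCodeOf {F : Type*} [Field F] (n : ℕ) (g : Polynomial F) :
    Submodule F (Fin n → F) where
  carrier := {c | g ∣ polyOfVec c}
  add_mem' := by
    intro a b ha hb
    have h : polyOfVec (a + b) = polyOfVec a + polyOfVec b := by
      simp [polyOfVec, add_mul, Finset.sum_add_distrib]
    simpa [Set.mem_setOf_eq, h] using dvd_add ha hb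
  zero_mem' := by simp [polyOfVec]
  smul_mem' := by
    intro r c hc
    have h : polyOfVec (r • c) = Polynomial.C r * polyOfVec c := by
      simp [polyOfVec, Finset.mul_sum, mul_assoc]
    simpa [Set.mem_setOf_eq, h] using hc.mul_left (Polynomial.C r)

/-- `f̄`: the polynomial obtained by raising every coefficient of `f` to the `q`-th power. -/
def conjPoly {F : Type*} [Field F] (q : ℕ) (f : Polynomial F) : Polynomial F :=
  f.sum fun i a => Polynomial.C (a ^ q) * Polynomial.X ^ i

/-- The reciprocal polynomial `f*(x) = f₀⁻¹ xᵗ f(1/x)`. -/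
def recipPoly {F : Type*} [Field F] (f : Polynomial F) : Polynomial F :=
  Polynomial.C (f.coeff 0)⁻¹ * f.reverse

/-- The `Q`-cyclotomic coset of `s` modulo `n`, as a subset of `{0,…,n−1} ⊆ ℕ`
(`s` is taken as an integer so that negative indices are allowed). -/
def cycCoset (Q n : ℕ) (s : ℤ) : Set ℕ :=
  {x | x < n ∧ ∃ j : ℕ, (x : ℤ) ≡ s * (Q : ℤ) ^ j [ZMOD n]}

end

section FiniteFieldExtension

variable {F E : Type*} [Field F] [Field E] [Fintype E] [Algebra F E]

theorem prod_image_minpoly_dvd_iff {ι : Type*} [DecidableEq F[X]] (S : Finset ι) (y : ι → E)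
    (f : F[X]) :
    ∏ p ∈ S.image (fun s => minpoly F (y s)), p ∣ f ↔ ∀ s ∈ S, aeval (y s) f = 0 := by
  constructor
  · intro h s hs
    have h1 : minpoly F (y s) ∣ f :=
      (Finset.dvd_prod_of_mem (fun p => p)
        (Finset.mem_image_of_mem (fun s => minpoly F (y s)) hs)).trans h
    exact (minpoly.dvd_iff).1 h1
  · intro h
    apply Finset.prod_dvd_of_coprime
    · intro p hp p' hp' hne
      simp only [Finset.coe_image, Set.mem_image] at hp hp'
      obtain ⟨s, -, rfl⟩ := hp
      obtain ⟨s', -, rfl⟩ := hp'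
      have hi := fun s => Algebra.IsIntegral.isIntegral (R := F) (y s)
      refine ((minpoly.irreducible (hi s)).coprime_iff_not_dvd).2 fun hd => hne ?_
      exact eq_of_monic_of_associated (minpoly.monic (hi s)) (minpoly.monic (hi s'))
        ((minpoly.irreducible (hi s)).associated_of_dvd (minpoly.irreducible (hi s')) hd)
    · intro p hp
      obtain ⟨s, hs, rfl⟩ := Finset.mem_image.1 hp
      exact minpoly.dvd F _ (h s hs)

variable [Fintype F]

theorem aeval_minpoly_eq_zero_iff_exists_pow {x y : E} :
    aeval x (minpoly F y) = 0 ↔ ∃ j : ℕ, x = y ^ Fintype.card F ^ j := by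
  constructor
  · intro h
    obtain ⟨σ, rfl⟩ := minpoly.exists_algEquiv_of_root' (Algebra.IsAlgebraic.isAlgebraic y) h
    obtain ⟨j, rfl⟩ := (FiniteField.bijective_frobeniusAlgEquivOfAlgebraic_pow F E).2 σ
    refine ⟨j, ?_⟩
    simp [AlgEquiv.coe_pow, FiniteField.coe_frobeniusAlgEquivOfAlgebraic_iterate]
  · rintro ⟨j, rfl⟩
    have h := congrFun (FiniteField.coe_frobeniusAlgEquivOfAlgebraic_iterate F E j) y
    rw [← AlgEquiv.coe_pow] at h
    rw [← h, ← AlgEquiv.coe_toAlgHom, aeval_algHom_apply, minpoly.aeval, map_zero]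

theorem aeval_pow_card_pow (f : F[X]) (x : E) (j : ℕ) :
    aeval (x ^ Fintype.card F ^ j) f = aeval x f ^ Fintype.card F ^ j := by
  have h := FiniteField.coe_frobeniusAlgEquivOfAlgebraic_iterate F E j
  rw [← AlgEquiv.coe_pow] at h
  have hx := fun y => congrFun h y
  rw [← hx, ← hx, ← AlgEquiv.coe_toAlgHom, aeval_algHom_apply]

theorem aeval_prod_image_minpoly_eq_zero_iff {ι : Type*} [DecidableEq F[X]] (S : Finset ι)
    (y : ι → E) (x : E) :
    aeval x (∏ p ∈ S.image (fun s => minpoly F (y s)), p) = 0 ↔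
      ∃ s ∈ S, ∃ j : ℕ, x = y s ^ Fintype.card F ^ j := by
  rw [map_prod, Finset.prod_eq_zero_iff]
  simp [aeval_minpoly_eq_zero_iff_exists_pow]

theorem eq_zero_of_forall_trace_mul_eq_zero {x : E}
    (h : ∀ z : E, Algebra.trace F E (z * x) = 0) : x = 0 :=
  (traceForm_nondegenerate F E).2 x fun z => by simpa [Algebra.traceForm_apply] using h z

end FiniteFieldExtension

section CyclicCode

variable {F E : Type*} [Field F] {n : ℕ}

theorem aeval_polyOfVec [Field E] [Algebra F E] (c : Fin n → F) (x : E) :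
    aeval x (polyOfVec c) = ∑ i, algebraMap F E (c i) * x ^ (i : ℕ) := by
  simp [polyOfVec, map_sum]

theorem mem_cyclicCodeOf {g : F[X]} {c : Fin n → F} : c ∈ cyclicCodeOf n g ↔ g ∣ polyOfVec c :=
  Iff.rfl

/-- The linear map sending a vector to its associated polynomial. -/
noncomputable def polyOfVecLinear (F : Type*) [Field F] (n : ℕ) : (Fin n → F) →ₗ[F] F[X] where
  toFun := polyOfVec
  map_add' a b := by simp [polyOfVec, add_mul, Finset.sum_add_distrib]
  map_smul' r c := by simp [polyOfVec, Finset.smul_sum, mul_assoc, smul_eq_C_mul]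

theorem polyOfVec_coeff {f : F[X]} (hf : f.degree < n) :
    polyOfVec (fun i : Fin n => f.coeff i) = f := by
  rw [polyOfVec, Fin.sum_univ_eq_sum_range (fun i => C (f.coeff i) * X ^ i) n]
  by_cases h0 : f = 0
  · simp [h0]
  · exact (f.as_sum_range_C_mul_X_pow' ((natDegree_lt_iff_degree_lt h0).2 hf)).symm

theorem finrank_cyclicCodeOf_add_natDegree {g : F[X]} (hg0 : g ≠ 0) (hg : g.natDegree ≤ n) :
    Module.finrank F (cyclicCodeOf n g) + g.natDegree = n := by
  let φ : (Fin n → F) →ₗ[F] F[X] ⧸ Ideal.span {g} :=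
    (Ideal.Quotient.mkₐ F (Ideal.span {g})).toLinearMap ∘ₗ polyOfVecLinear F n
  have hker : LinearMap.ker φ = cyclicCodeOf n g := by
    ext c
    rw [mem_cyclicCodeOf, LinearMap.mem_ker, ← Ideal.mem_span_singleton,
      ← Ideal.Quotient.eq_zero_iff_mem]
    rfl
  have hrange : LinearMap.range φ = ⊤ := by
    refine LinearMap.range_eq_top.2 fun z => ?_
    obtain ⟨p, rfl⟩ := Ideal.Quotient.mk_surjective z
    have hd : (p % g).degree < n :=
      (EuclideanDomain.mod_lt p hg0).trans_le (degree_le_of_natDegree_le hg)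
    refine ⟨fun i => (p % g).coeff i, ?_⟩
    change Ideal.Quotient.mk _ (polyOfVec _) = _
    rw [polyOfVec_coeff hd, Ideal.Quotient.eq, Ideal.mem_span_singleton]
    exact dvd_sub_comm.1 ⟨p / g, sub_eq_of_eq_add' (EuclideanDomain.mod_add_div p g).symm⟩
  have h := φ.finrank_range_add_finrank_ker
  rw [hker, hrange, finrank_top, finrank_quotient_span_eq_natDegree] at h
  simpa [add_comm] using h

/-- The BCH bound. -/
theorem lt_hammingNorm_of_consecutive_roots [DecidableEq F] [Field E] [Algebra F E] {α : E}
    (hα : orderOf α = n) {L : ℕ} {b : ℤ} {c : Fin n → F} (hc : c ≠ 0)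
    (h : ∀ l < L, aeval (α ^ (b + l)) (polyOfVec c) = 0) : L < hammingNorm c := by
  classical
  by_contra! hL
  obtain ⟨i₀, hi₀⟩ : ∃ i, c i ≠ 0 := by
    by_contra! h0
    exact hc (funext h0)
  have hn : 0 < n := i₀.pos
  have hα0 : α ≠ 0 := by
    rintro rfl
    rw [← hα, orderOf_zero] at hn
    exact hn.false
  have hlin : ∀ p : E[X], p.natDegree < L →
      ∑ i, algebraMap F E (c i) * (α ^ b) ^ (i : ℕ) * p.eval (α ^ (i : ℕ)) = 0 := by
    intro p hp
    simp_rw [eval_eq_sum_range' hp, Finset.mul_sum]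
    rw [Finset.sum_comm]
    refine Finset.sum_eq_zero fun l hl => ?_
    have hl' := h l (Finset.mem_range.1 hl)
    rw [aeval_polyOfVec, zpow_add₀ hα0, zpow_natCast] at hl'
    calc _ = p.coeff l * ∑ i, algebraMap F E (c i) * (α ^ b * α ^ l) ^ (i : ℕ) := by
          rw [Finset.mul_sum]
          refine Finset.sum_congr rfl fun i _ => ?_
          rw [mul_pow, ← pow_mul, ← pow_mul, mul_comm l]
          ring
      _ = 0 := by rw [hl', mul_zero]
  set T : Finset (Fin n) := Finset.univ.filter fun i => c i ≠ 0 with hT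
  have hi₀T : i₀ ∈ T := by simp [hT, hi₀]
  have hTL : T.card ≤ L := hL
  have hdeg : (∏ i ∈ T.erase i₀, (X - C (α ^ (i : ℕ)))).natDegree < L := by
    rw [natDegree_prod_of_monic _ _ fun i _ => monic_X_sub_C _]
    simp only [natDegree_X_sub_C, Finset.sum_const, smul_eq_mul, mul_one]
    exact (Finset.card_erase_lt_of_mem hi₀T).trans_le hTL
  have key := hlin _ hdeg
  rw [Finset.sum_eq_single i₀] at key
  · simp only [mul_eq_zero, map_eq_zero, hi₀, false_or, pow_eq_zero_iff',
      eval_prod, Finset.prod_eq_zero_iff, eval_sub, eval_X, eval_C, sub_eq_zero] at key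
    rcases key with ⟨hz, -⟩ | ⟨i, hi, he⟩
    · exact zpow_ne_zero b hα0 hz
    · refine (Finset.mem_erase.1 hi).1 (Fin.ext ?_)
      exact (pow_injOn_Iio_orderOf (by simp [hα]) (by simp [hα]) he).symm
  · intro i _ hne
    by_cases hci : c i = 0
    · simp [hci]
    · have : i ∈ T.erase i₀ := by simp [hT, hci, hne]
      rw [eval_prod, Finset.prod_eq_zero this (by simp), mul_zero]
  · simp

theorem sum_pow_eq_zero_of_pow_eq_one [Field E] {x : E} (hx : x ^ n = 1) (hx1 : x ≠ 1) :
    ∑ i : Fin n, x ^ (i : ℕ) = 0 := by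
  rw [Fin.sum_univ_eq_sum_range (fun i => x ^ i) n]
  have := geom_sum_mul x n
  rw [hx, sub_self, mul_eq_zero, sub_eq_zero] at this
  exact this.resolve_right hx1

variable [Fintype F] [Field E] [Fintype E] [Algebra F E]

/-- The codewords `(Tr(θ y⁻ⁱ))ᵢ` for `y` not a root of the generator polynomial. -/
theorem trace_mem_cyclicCodeOf {g : F[X]} {n : ℕ}
    (hE : ∀ x : E, x ≠ 0 → x ^ n = 1)
    (hg : ∀ f : F[X], (∀ x : E, aeval x g = 0 → aeval x f = 0) → g ∣ f)
    (hg0 : aeval (0 : E) g ≠ 0) {y : E} (hy0 : y ≠ 0) (hy : aeval y g ≠ 0) (θ : E) :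
    (fun i : Fin n => Algebra.trace F E (θ * y⁻¹ ^ (i : ℕ))) ∈ cyclicCodeOf n g := by
  rw [mem_cyclicCodeOf]
  refine hg _ fun x hx => ?_
  have hx0 : x ≠ 0 := by
    rintro rfl
    exact hg0 hx
  simp_rw [aeval_polyOfVec, FiniteField.algebraMap_trace_eq_sum_pow, Finset.sum_mul]
  rw [Finset.sum_comm]
  refine Finset.sum_eq_zero fun j _ => ?_
  rw [Nat.card_eq_fintype_card]
  have hne : y⁻¹ ^ Fintype.card F ^ j * x ≠ 1 := by
    intro h
    rw [inv_pow, inv_mul_eq_one₀ (pow_ne_zero _ hy0)] at h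
    rw [← h, aeval_pow_card_pow] at hx
    exact hy (eq_zero_of_pow_eq_zero hx)
  calc _ = θ ^ Fintype.card F ^ j *
        ∑ i : Fin n, (y⁻¹ ^ Fintype.card F ^ j * x) ^ (i : ℕ) := by
        rw [Finset.mul_sum]
        refine Finset.sum_congr rfl fun i _ => ?_
        rw [mul_pow, mul_pow, pow_right_comm, mul_assoc]
    _ = 0 := by
        rw [sum_pow_eq_zero_of_pow_eq_one _ hne, mul_zero]
        exact hE _ (mul_ne_zero (pow_ne_zero _ (inv_ne_zero hy0)) hx0)

/-- A cyclic code whose set of roots is stable under `x ↦ x^{-q}` is Hermitian LCD. -/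
theorem isHermitianLCD_of_root_stable {g : F[X]} {n q : ℕ} (φ : E →+* E) (hφ : ∀ x, φ x = x ^ q)
    (hn : n = Fintype.card E - 1)
    (hg : ∀ f : F[X], (∀ x : E, aeval x g = 0 → aeval x f = 0) → g ∣ f)
    (hg0 : aeval (0 : E) g ≠ 0)
    (hstable : ∀ x : E, aeval x g = 0 → aeval (x⁻¹ ^ q) g = 0) :
    IsHermitianLCD q ((cyclicCodeOf n g : Submodule F (Fin n → F)) : Set (Fin n → F)) := by
  classical
  have hφb : Function.Bijective φ := Finite.injective_iff_bijective.1 φ.injective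
  have hE : ∀ x : E, x ≠ 0 → x ^ n = 1 := fun x hx => by
    rw [hn, FiniteField.pow_card_sub_one_eq_one x hx]
  have hinj : Function.Injective fun x : E => x⁻¹ ^ q := fun x y h => by
    simp only [← hφ] at h
    exact inv_injective (hφb.1 h)
  have hstable' : ∀ x : E, aeval (x⁻¹ ^ q) g = 0 → aeval x g = 0 := by
    have hmaps : Set.MapsTo (fun x : E => x⁻¹ ^ q) {x | aeval x g = 0} {x | aeval x g = 0} :=
      fun x hx => hstable x hx
    have hbij := ((Set.toFinite {x : E | aeval x g = 0}).injOn_iff_bijOn_of_mapsTo hmaps).1 hinj.injOn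
    intro x hx
    obtain ⟨y, hy, hyx⟩ := hbij.surjOn hx
    exact hinj hyx ▸ hy
  apply Set.eq_singleton_iff_unique_mem.2
  refine ⟨⟨Submodule.zero_mem _, fun c _ => by simp⟩, ?_⟩
  rintro b ⟨hb, hbd⟩
  have hroot : ∀ x : E, x ≠ 0 → aeval x (polyOfVec b) = 0 := by
    intro x hx0
    by_cases hx : aeval x g = 0
    · obtain ⟨r, hr⟩ := mem_cyclicCodeOf.1 hb
      rw [hr, map_mul, hx, zero_mul]
    obtain ⟨z, hz⟩ := hφb.2 x
    have hz0 : z ≠ 0 := by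
      rintro rfl
      exact hx0 (by rw [← hz, map_zero])
    have hzq : (z⁻¹)⁻¹ ^ q = x := by rw [inv_inv, ← hφ, hz]
    have hy : aeval z⁻¹ g ≠ 0 := fun h => hx (hzq ▸ hstable _ h)
    refine eq_zero_of_forall_trace_mul_eq_zero (F := F) fun w => ?_
    obtain ⟨θ, rfl⟩ := hφb.2 w
    have h := hbd _ (trace_mem_cyclicCodeOf hE hg hg0 (inv_ne_zero hz0) hy θ)
    have h' := congrArg (algebraMap F E) h
    apply (algebraMap F E).injective
    rw [map_zero] at h' ⊢
    rw [← h', map_sum, FiniteField.algebraMap_trace_eq_sum_pow]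
    simp_rw [map_mul, map_pow, FiniteField.algebraMap_trace_eq_sum_pow, ← hφ, map_sum, map_pow,
      Finset.mul_sum, Nat.card_eq_fintype_card]
    rw [Finset.sum_comm]
    refine Finset.sum_congr rfl fun j _ => ?_
    rw [mul_pow, ← aeval_pow_card_pow, aeval_polyOfVec, Finset.mul_sum]
    refine Finset.sum_congr rfl fun i _ => ?_
    rw [map_mul, map_pow, inv_inv, hz, mul_pow, pow_right_comm]
    ring
  have hpoly : polyOfVec b = 0 := by
    by_cases hn0 : n = 0
    · subst hn0
      simp [polyOfVec]
    apply Polynomial.map_injective (algebraMap F E) (algebraMap F E).injective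
    rw [Polynomial.map_zero]
    refine eq_zero_of_natDegree_lt_card_of_eval_eq_zero' _ (Finset.univ.erase (0 : E)) ?_ ?_
    · intro x hx
      rw [eval_map_algebraMap]
      exact hroot x (Finset.ne_of_mem_erase hx)
    · rw [Finset.card_erase_of_mem (Finset.mem_univ _), Finset.card_univ, ← hn, natDegree_map]
      refine (natDegree_sum_le_of_forall_le (n := n - 1) _ _ fun i _ => ?_).trans_lt (by omega)
      exact (natDegree_C_mul_X_pow_le _ _).trans (by omega)
  ext i
  have hi := congrArg (fun p => coeff p (i : ℕ)) hpoly
  simpa [polyOfVec, finsetSum_coeff, coeff_X_pow, Fin.val_inj] using hi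

end CyclicCode

section CyclotomicCosets

variable {q m i i' t j j' : ℕ}

theorem coprime_pow_pow_sub_one {a k : ℕ} (ha : 0 < a) (hk : k ≠ 0) (s : ℕ) :
    Nat.Coprime (a ^ k - 1) (a ^ s) := by
  refine Nat.Coprime.pow_right s (Nat.Coprime.symm ?_)
  refine Nat.Coprime.coprime_dvd_left (dvd_pow_self a hk) ?_
  exact (Nat.coprime_self_sub_right (Nat.one_le_pow _ _ ha)).2 (by simp)

theorem pow_modEq_one_sub_one {a k : ℕ} (ha : 0 < a) : a ^ k ≡ 1 [MOD a ^ k - 1] :=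
  ((Nat.modEq_iff_dvd' (Nat.one_le_pow _ _ ha)).2 dvd_rfl).symm

theorem eq_of_modEq_mul_pow_of_two_mul_le (hq : 2 ≤ q) (hm : m ≠ 0) (hi : i < q ^ m)
    (hi' : i' < q ^ m) (hdvd : ¬ q ^ 2 ∣ i) (ht : 2 * t ≤ m)
    (h : i ≡ i' * q ^ (2 * t) [MOD q ^ (2 * m) - 1]) : t = 0 ∧ i = i' := by
  have hP : 2 ≤ q ^ m := hq.trans (Nat.le_self_pow hm q)
  have hPP : q ^ (2 * m) = q ^ m * q ^ m := by rw [two_mul, pow_add]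
  have hR : q ^ (2 * t) ≤ q ^ m := Nat.pow_le_pow_right (by omega) ht
  have heq : i = i' * q ^ (2 * t) := by
    refine h.eq_of_lt_of_lt ?_ ?_
    · rw [hPP]
      have : 2 * q ^ m ≤ q ^ m * q ^ m := Nat.mul_le_mul_right _ hP
      omega
    · have h1 : i' * q ^ (2 * t) ≤ (q ^ m - 1) * q ^ m :=
        Nat.mul_le_mul (by omega) hR
      rw [Nat.sub_mul, one_mul, ← hPP] at h1
      have : q ^ m ≤ q ^ (2 * m) := Nat.pow_le_pow_right (by omega) (by omega)
      omega
  rcases Nat.eq_zero_or_pos t with rfl | ht0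
  · simpa using heq
  · exact absurd (heq ▸ Dvd.dvd.mul_left (pow_dvd_pow q (by omega)) _) hdvd

theorem eq_of_modEq_mul_pow (hq : 2 ≤ q) (hi : i < q ^ m)
    (hi' : i' < q ^ m) (hdvd : ¬ q ^ 2 ∣ i) (hdvd' : ¬ q ^ 2 ∣ i') (ht : t < m)
    (h : i ≡ i' * q ^ (2 * t) [MOD q ^ (2 * m) - 1]) : t = 0 ∧ i = i' := by
  rcases le_or_gt (2 * t) m with h2 | h2
  · exact eq_of_modEq_mul_pow_of_two_mul_le hq (by omega) hi hi' hdvd h2 h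
  · have h3 := h.mul_right (q ^ (2 * (m - t)))
    rw [mul_assoc, ← pow_add, show 2 * t + 2 * (m - t) = 2 * m by omega] at h3
    have h4 := h3.trans ((pow_modEq_one_sub_one (a := q) (k := 2 * m) (by omega)).mul_left i')
    rw [mul_one] at h4
    have := eq_of_modEq_mul_pow_of_two_mul_le hq (by omega) hi' hi hdvd' (by omega) h4.symm
    omega

theorem eq_of_mul_pow_modEq_mul_pow (hq : 2 ≤ q) (hi : i < q ^ m) (hi' : i' < q ^ m)
    (hdvd : ¬ q ^ 2 ∣ i) (hdvd' : ¬ q ^ 2 ∣ i') (hj : j < m) (hj' : j' < m)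
    (h : i * q ^ (2 * j) ≡ i' * q ^ (2 * j') [MOD q ^ (2 * m) - 1]) : i = i' ∧ j = j' := by
  wlog hle : j ≤ j' generalizing i i' j j'
  · have := this hi' hi hdvd' hdvd hj' hj h.symm (by omega)
    exact ⟨this.1.symm, this.2.symm⟩
  rw [show 2 * j' = 2 * (j' - j) + 2 * j by omega, pow_add, ← mul_assoc] at h
  have h2 := Nat.ModEq.cancel_right_of_coprime
    (coprime_pow_pow_sub_one (by omega) (by omega) _) h
  have := eq_of_modEq_mul_pow hq hi hi' hdvd hdvd' (by omega) h2
  exact ⟨this.2, by omega⟩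

theorem not_dvd_mul_pow_add_mul (hq : 2 ≤ q) (hm : 2 ≤ m) (hmeven : Even m) (hi0 : 0 < i)
    (hi : i < q ^ m) (hi' : i' < q ^ m) (ht : t < m) :
    ¬ q ^ (2 * m) - 1 ∣ i * q ^ (2 * t) + q * i' := by
  intro h
  obtain ⟨k, rfl⟩ := hmeven
  obtain ⟨k, rfl⟩ : ∃ l, k = l + 1 := ⟨k - 1, by omega⟩
  set P := q ^ (k + 1 + (k + 1)) with hP
  have hPP : q ^ (2 * (k + 1 + (k + 1))) = P * P := by rw [two_mul, pow_add]
  have hPR : P = q ^ (2 * k) * q * q := by rw [hP]; ring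
  have hR : 1 ≤ q ^ (2 * k) := Nat.one_le_pow _ _ (by omega)
  have hRP : q ^ (2 * k) + q ≤ P := by
    have h1 : q ^ (2 * k) * 1 ≤ q ^ (2 * k) * q := Nat.mul_le_mul_left _ (by omega)
    have h2 : 1 * q ≤ q ^ (2 * k) * q := Nat.mul_le_mul_right _ hR
    have h3 : q ^ (2 * k) * q * 2 ≤ P := hPR ▸ Nat.mul_le_mul_left _ hq
    omega
  have hSP : 1 + q ^ (2 * k) * q ≤ P := by
    rw [hPR]
    have : 1 ≤ q ^ (2 * k) * q := Nat.mul_pos (by omega) (by omega)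
    nlinarith
  have hq0 : ∀ s, 0 < q ^ s := fun s => pow_pos (by omega) s
  have hP1 : q + 1 ≤ P := by omega
  have hPPP : P ≤ P * P := Nat.le_mul_self P
  rw [hPP] at h
  rcases lt_trichotomy t (k + 1) with h1 | rfl | h1
  · have hle := Nat.le_of_dvd (by have := Nat.mul_pos hi0 (hq0 (2 * t)); omega) h
    have ht' : q ^ (2 * t) ≤ q ^ (2 * k) := Nat.pow_le_pow_right (by omega) (by omega)
    have h2 : i * q ^ (2 * t) ≤ (P - 1) * q ^ (2 * k) := Nat.mul_le_mul (by omega) ht'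
    have h3 : q * i' ≤ q * (P - 1) := Nat.mul_le_mul_left _ (by omega)
    have h4 : (P - 1) * (q ^ (2 * k) + q) ≤ (P - 1) * P := Nat.mul_le_mul_left _ hRP
    have h5 : (P - 1) * P = P * P - P := by rw [Nat.sub_mul, one_mul]
    have h6 : (P - 1) * (q ^ (2 * k) + q) = (P - 1) * q ^ (2 * k) + q * (P - 1) := by ring
    omega
  · rw [show 2 * (k + 1) = k + 1 + (k + 1) by ring, ← hP] at h
    have h2 : i * P ≤ (P - 1) * P := Nat.mul_le_mul_right _ (by omega)
    have h3 : q * i' ≤ q * (P - 1) := Nat.mul_le_mul_left _ (by omega)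
    have h3' : q * (P - 1) ≤ (P - 1) * (P - 1) := Nat.mul_le_mul_right _ (by omega)
    have h3'' : (P - 1) * (P - 1) ≤ (P - 1) * P := Nat.mul_le_mul_left _ (by omega)
    have h5 : (P - 1) * P = P * P - P := by rw [Nat.sub_mul, one_mul]
    have hpos : 0 < i * P := Nat.mul_pos hi0 (by omega)
    have heq : i * P + q * i' = P * P - 1 :=
      Nat.eq_of_dvd_of_lt_two_mul (by omega) h (by omega)
    have hqd : q ∣ 1 := by
      have hqP : q ∣ P := hPR ▸ dvd_mul_left q _
      have h6 : q ∣ P * P - 1 := heq ▸ dvd_add (hqP.mul_left i) (dvd_mul_right q i')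
      have h7 := Nat.dvd_sub (hqP.mul_left P) h6
      rwa [show P * P - (P * P - 1) = 1 by omega] at h7
    have := Nat.le_of_dvd one_pos hqd
    omega
  · obtain ⟨u, hu⟩ : ∃ u, u = 2 * (k + 1) - t := ⟨_, rfl⟩
    have hmod : i * q ^ (2 * t) * q ^ (2 * u) ≡ i [MOD P * P - 1] := by
      rw [mul_assoc, ← pow_add q (2 * t), ← hPP, show 2 * t + 2 * u = 2 * (k + 1 + (k + 1)) by omega]
      simpa using (pow_modEq_one_sub_one (a := q) (by omega)).mul_left i
    have h2 : P * P - 1 ∣ i + q * i' * q ^ (2 * u) := by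
      have h3 := h.mul_right (q ^ (2 * u))
      rw [add_mul] at h3
      exact ((hmod.add_right _).dvd_iff dvd_rfl).1 h3
    have hle := Nat.le_of_dvd (by omega) h2
    have ht' : q ^ (2 * u) ≤ q ^ (2 * k) := Nat.pow_le_pow_right (by omega) (by omega)
    have h3 : i' * (q ^ (2 * u) * q) ≤ (P - 1) * (q ^ (2 * k) * q) :=
      Nat.mul_le_mul (by omega) (Nat.mul_le_mul_right _ ht')
    have h4 : (P - 1) * (1 + q ^ (2 * k) * q) ≤ (P - 1) * P := Nat.mul_le_mul_left _ hSP
    have h5 : (P - 1) * P = P * P - P := by rw [Nat.sub_mul, one_mul]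
    have h6 : (P - 1) * (1 + q ^ (2 * k) * q) = (P - 1) + (P - 1) * (q ^ (2 * k) * q) := by ring
    have h7 : q * i' * q ^ (2 * u) = i' * (q ^ (2 * u) * q) := by ring
    omega

theorem not_dvd_mul_pow_add_mul_mul_pow (hq : 2 ≤ q) (hm : 2 ≤ m) (hmeven : Even m) (hi0 : 0 < i)
    (hi : i < q ^ m) (hi' : i' < q ^ m) (hj : j < m) (hj' : j' < m) :
    ¬ q ^ (2 * m) - 1 ∣ i * q ^ (2 * j) + q * (i' * q ^ (2 * j')) := by
  intro h
  have hcop := coprime_pow_pow_sub_one (a := q) (k := 2 * m) (by omega) (by omega)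
  rcases le_or_gt j' j with hle | hlt
  · refine not_dvd_mul_pow_add_mul hq hm hmeven hi0 hi hi' (t := j - j') (by omega) ?_
    refine (hcop (2 * j')).dvd_of_dvd_mul_right (?_ : _ ∣ _ * q ^ (2 * j'))
    rw [show 2 * j = 2 * (j - j') + 2 * j' by omega, pow_add] at h
    convert h using 1
    ring
  · refine not_dvd_mul_pow_add_mul hq hm hmeven hi0 hi hi' (t := m + j - j') (by omega) ?_
    refine (hcop (2 * j')).dvd_of_dvd_mul_right (?_ : _ ∣ _ * q ^ (2 * j'))
    have hmod := ((pow_modEq_one_sub_one (a := q) (k := 2 * m) (by omega)).mul_left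
      (i * q ^ (2 * j))).add_right (q * (i' * q ^ (2 * j')))
    rw [mul_one, mul_assoc, ← pow_add] at hmod
    rw [add_mul, mul_assoc, ← pow_add, mul_assoc q,
      show 2 * (m + j - j') + 2 * j' = 2 * j + 2 * m by omega]
    exact (hmod.dvd_iff dvd_rfl).2 h

theorem not_dvd_mul_pow (hq : 2 ≤ q) (hm : 2 ≤ m) (hi0 : 0 < i) (hi : i < q ^ m) :
    ¬ q ^ (2 * m) - 1 ∣ i * q ^ (2 * j) := by
  intro h
  have h1 := (coprime_pow_pow_sub_one (a := q) (k := 2 * m) (by omega) (by omega)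
    (2 * j)).dvd_of_dvd_mul_right h
  have h2 := Nat.le_of_dvd hi0 h1
  have h3 : q ^ m < q ^ (2 * m) := Nat.pow_lt_pow_right (by omega) (by omega)
  omega

end CyclotomicCosets

section RootSet

variable {q m n : ℕ} {E : Type*} [Field E] {α ω : E}

theorem eq_of_pow_mul_pow_eq_pow_mul_pow (hn : n = q ^ (2 * m) - 1) (hα : orderOf α = n)
    (hα0 : α ≠ 0) (hq : 2 ≤ q)
    {i i' j j' : ℕ} (hi : i < q ^ m) (hi' : i' < q ^ m) (hdvd : ¬ q ^ 2 ∣ i)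
    (hdvd' : ¬ q ^ 2 ∣ i') (hj : j < m) (hj' : j' < m)
    (h : α ^ (i * (q ^ 2) ^ j) = α ^ (i' * (q ^ 2) ^ j')) : i = i' ∧ j = j' := by
  lift α to Eˣ using isUnit_iff_ne_zero.2 hα0
  rw [orderOf_units] at hα
  norm_cast at h
  rw [pow_eq_pow_iff_modEq, hα, hn, ← pow_mul, ← pow_mul] at h
  exact eq_of_mul_pow_modEq_mul_pow hq hi hi' hdvd hdvd' hj hj' h

/-- The representatives of the cyclotomic cosets that meet `{1, …, δ - 1}`. -/
def cosetReps (q m δ : ℕ) : Finset (ℕ × ℕ) :=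
  ((Finset.Ioc 0 (δ - 1)).filter fun i => ¬ q ^ 2 ∣ i) ×ˢ Finset.range m

theorem card_cosetReps (q m δ : ℕ) :
    (cosetReps q m δ).card = (δ - 1 - (δ - 1) / q ^ 2) * m := by
  have h := Finset.card_filter_add_card_filter_not (s := Finset.Ioc 0 (δ - 1))
    (fun i => q ^ 2 ∣ i)
  rw [Nat.Ioc_filter_dvd_card_eq_div, Nat.card_Ioc] at h
  rw [cosetReps, Finset.card_product, Finset.card_range]
  congr 1
  simp only [Nat.sub_zero] at h
  exact Nat.eq_sub_of_add_eq' h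

theorem mem_cosetReps {q m δ : ℕ} (hm : 2 ≤ m) (hδ : δ ≤ q ^ m + 1) {p : ℕ × ℕ} :
    p ∈ cosetReps q m δ → 0 < p.1 ∧ p.1 ≤ δ - 1 ∧ p.1 < q ^ m ∧ ¬ q ^ 2 ∣ p.1 ∧ p.2 < m := by
  simp only [cosetReps, Finset.mem_product, Finset.mem_filter, Finset.mem_Ioc, Finset.mem_range]
  rintro ⟨⟨⟨h0, hle⟩, hd⟩, hj⟩
  refine ⟨h0, hle, lt_of_le_of_ne (by omega) ?_, hd, hj⟩
  intro h
  exact hd (h ▸ pow_dvd_pow q hm)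

variable [DecidableEq E]

/-- The set of roots of the generator polynomial, without repetition. -/
def rootFinset (q m δ : ℕ) (α ω : E) : Finset E :=
  insert ω ((cosetReps q m δ).image (fun p => ω * α ^ (p.1 * (q ^ 2) ^ p.2)) ∪
    (cosetReps q m δ).image fun p => ω * (α ^ (p.1 * (q ^ 2) ^ p.2))⁻¹ ^ q)

theorem card_rootFinset {δ : ℕ} (hn : n = q ^ (2 * m) - 1) (hα : orderOf α = n) (hq : 2 ≤ q)
    (hm : 2 ≤ m) (hmeven : Even m) (hδ : δ ≤ q ^ m + 1) (hα0 : α ≠ 0) (hω : ω ≠ 0)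
    (φ : E →+* E) (hφ : ∀ x, φ x = x ^ q) :
    (rootFinset q m δ α ω).card = 1 + 2 * ((δ - 1 - (δ - 1) / q ^ 2) * m) := by
  have hmem := fun p => mem_cosetReps (q := q) hm hδ (p := p)
  have hinj : Set.InjOn (fun p : ℕ × ℕ => α ^ (p.1 * (q ^ 2) ^ p.2)) (cosetReps q m δ) := by
    intro p hp p' hp' h
    obtain ⟨-, -, h1, h2, h3⟩ := hmem p hp
    obtain ⟨-, -, h1', h2', h3'⟩ := hmem p' hp'
    have := eq_of_pow_mul_pow_eq_pow_mul_pow hn hα hα0 hq h1 h1' h2 h2' h3 h3' h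
    exact Prod.ext this.1 this.2
  have hone : ∀ p ∈ cosetReps q m δ, α ^ (p.1 * (q ^ 2) ^ p.2) ≠ 1 := by
    intro p hp h
    obtain ⟨h0, -, h1, -, -⟩ := hmem p hp
    rw [← orderOf_dvd_iff_pow_eq_one, hα, hn, ← pow_mul] at h
    exact not_dvd_mul_pow hq hm h0 h1 h
  rw [rootFinset, Finset.card_insert_of_notMem, Finset.card_union_of_disjoint,
    Finset.card_image_of_injOn, Finset.card_image_of_injOn, card_cosetReps]
  · ring
  · intro p hp p' hp' h
    refine hinj hp hp' (inv_injective (φ.injective ?_))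
    rw [hφ, hφ]
    exact mul_left_cancel₀ hω h
  · exact fun p hp p' hp' h => hinj hp hp' (mul_left_cancel₀ hω h)
  · rw [Finset.disjoint_left]
    intro x hx hx'
    obtain ⟨p, hp, rfl⟩ := Finset.mem_image.1 hx
    obtain ⟨p', hp', h⟩ := Finset.mem_image.1 hx'
    have h' := mul_left_cancel₀ hω h
    rw [inv_pow, inv_eq_iff_eq_inv, ← mul_eq_one_iff_eq_inv₀ (pow_ne_zero _ hα0), ← pow_mul, ← pow_add,
      ← orderOf_dvd_iff_pow_eq_one, hα, hn, ← pow_mul, ← pow_mul] at h'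
    obtain ⟨h0, -, h1, -, h3⟩ := hmem p hp
    obtain ⟨-, -, h1', -, h3'⟩ := hmem p' hp'
    refine not_dvd_mul_pow_add_mul_mul_pow hq hm hmeven h0 h1 h1' h3 h3' ?_
    rw [add_comm, mul_comm q]
    exact h'
  · intro h
    rcases Finset.mem_union.1 h with h | h
    · obtain ⟨p, hp, h⟩ := Finset.mem_image.1 h
      exact hone p hp (mul_left_cancel₀ hω (h.trans (mul_one ω).symm))
    · obtain ⟨p, hp, h⟩ := Finset.mem_image.1 h
      have h' := mul_left_cancel₀ hω (h.trans (mul_one ω).symm)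
      rw [← hφ, ← φ.map_one, φ.injective.eq_iff, inv_eq_one] at h'
      exact hone p hp h'

theorem mem_rootFinset_iff [Fintype E] {δ : ℕ} (hE : Fintype.card E = (q ^ 2) ^ m)
    (hq : 2 ≤ q) (hm : 2 ≤ m) (x : E) :
    x ∈ rootFinset q m δ α ω ↔ x = ω ∨ ∃ i ∈ Finset.Icc 1 (δ - 1), ∃ j : ℕ,
      x = ω * α ^ (i * (q ^ 2) ^ j) ∨ x = ω * (α ^ (i * (q ^ 2) ^ j))⁻¹ ^ q := by
  have hred : ∀ i ∈ Finset.Icc 1 (δ - 1), ∀ j : ℕ, ∃ p ∈ cosetReps q m δ,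
      α ^ (i * (q ^ 2) ^ j) = α ^ (p.1 * (q ^ 2) ^ p.2) := by
    intro i hi j
    rw [Finset.mem_Icc] at hi
    obtain ⟨t, i', hd, rfl⟩ := Nat.exists_eq_pow_mul_and_not_dvd (n := i) (by omega) (q ^ 2)
      (by nlinarith)
    have hi' : 0 < i' := Nat.pos_of_ne_zero (by rintro rfl; simp at hd)
    have hle : i' ≤ (q ^ 2) ^ t * i' := Nat.le_mul_of_pos_left _ (by positivity)
    refine ⟨(i', (t + j) % m), ?_, ?_⟩
    · simp only [cosetReps, Finset.mem_product, Finset.mem_filter, Finset.mem_Ioc,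
        Finset.mem_range]
      exact ⟨⟨⟨hi', by omega⟩, hd⟩, Nat.mod_lt _ (by omega)⟩
    · rw [mul_comm _ i', mul_assoc, ← pow_add]
      conv_lhs => rw [← Nat.div_add_mod (t + j) m, pow_add, pow_mul (q ^ 2), ← hE,
        mul_left_comm, pow_mul, FiniteField.pow_card_pow]
  simp only [rootFinset, Finset.mem_insert, Finset.mem_union, Finset.mem_image]
  refine or_congr_right ⟨?_, ?_⟩
  · rintro (⟨p, hp, rfl⟩ | ⟨p, hp, rfl⟩)
    all_goals
      simp only [cosetReps, Finset.mem_product, Finset.mem_filter, Finset.mem_Ioc] at hp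
      refine ⟨p.1, Finset.mem_Icc.2 hp.1.1, p.2, ?_⟩
      simp
  · rintro ⟨i, hi, j, rfl | rfl⟩
    all_goals obtain ⟨p, hp, h⟩ := hred i hi j
    · exact Or.inl ⟨p, hp, by rw [h]⟩
    · exact Or.inr ⟨p, hp, by rw [h]⟩

end RootSet

/-- (Theorem on the Hermitian LCD code of length `Qᵐ − 1`, `m` even.)
The cyclic code with generator polynomial
`g = (x − α^n̂)·g_{(n,δ,n̂+1)}·lcm(m_{n̂−q(δ−1)},…,m_{n̂−q})`, i.e. the lcm (= product of the
distinct values) of the minimal polynomials `m_s` for `s ∈ {n̂} ∪ {n̂+1,…,n̂+δ−1} ∪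
{n̂−q(δ−1),…,n̂−q}`, is Hermitian LCD of dimension `Qᵐ − 2 − 2(δ − 1 − ⌊(δ−1)/Q⌋)m`
and minimum distance `≥ δ + 1 + ⌊(δ−1)/q⌋`. -/
theorem stmt12 {q Q m e n nh δ : ℕ} (hq : IsPrimePow q) (hQ : Q = q ^ 2) (hm : 2 ≤ m)
    (hmeven : m % 2 = 0) (he : e ∣ q + 1) (he0 : 0 < e) (hn : n = Q ^ m - 1)
    (hnh : nh = n / e) (hδ1 : 2 ≤ δ) (hδ2 : δ ≤ q ^ m + 1)
    {F : Type*} [Field F] [Fintype F] [DecidableEq F] (hF : Fintype.card F = Q)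
    {E : Type*} [Field E] [Fintype E] [DecidableEq E] [Algebra F E]
    (hE : Fintype.card E = Q ^ m) (α : E) (hα : orderOf α = n)
    (g : Polynomial F)
    (hg : g = ∏ p ∈ ((insert ((nh : ℤ))
        (((Finset.Icc 1 (δ - 1)).image fun i : ℕ => (nh : ℤ) + i) ∪
          ((Finset.Icc 1 (δ - 1)).image fun i : ℕ => (nh : ℤ) - q * i))).image
            fun s : ℤ => minpoly F (α ^ s)), p) :
    IsHermitianLCD q ((cyclicCodeOf n g : Submodule F (Fin n → F)) : Set (Fin n → F)) ∧
    (Module.finrank F (cyclicCodeOf n g) : ℤ)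
        = (Q : ℤ) ^ m - 2 - 2 * ((δ - 1 - (δ - 1) / Q : ℕ) : ℤ) * m ∧
    (∀ c ∈ cyclicCodeOf n g, c ≠ 0 → δ + 1 + (δ - 1) / q ≤ hammingNorm c) := by
  have hq2 : 2 ≤ q := hq.two_le
  have hme : Even m := Nat.even_iff.2 hmeven
  have hnq : n = q ^ (2 * m) - 1 := by rw [hn, hQ, pow_mul]
  have hE2 : Fintype.card E = (q ^ 2) ^ m := by rw [hE, hQ]
  have hnE : n = Fintype.card E - 1 := by rw [hE, hn]
  have hcardE : 1 < Fintype.card E := Fintype.one_lt_card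
  have hn0 : 0 < n := by omega
  have hα0 : α ≠ 0 := by
    rintro rfl
    rw [orderOf_zero] at hα
    omega
  obtain ⟨φ, hφ⟩ : ∃ φ : E →+* E, ∀ x, φ x = x ^ q := by
    obtain ⟨p, k, hp, hk, rfl⟩ := hq
    have hp' := hp.nat_prime
    obtain ⟨p', hchar⟩ := CharP.exists E
    obtain ⟨r, hp'', hr⟩ := FiniteField.card E p'
    have hpp : p' = p := by
      have h1 : p' ∣ p ^ (k * (2 * m)) := by
        rw [pow_mul p k, pow_mul, ← hE2, hr]
        exact dvd_pow_self _ r.ne_zero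
      exact (Nat.prime_dvd_prime_iff_eq hp'' hp').1 (hp''.dvd_of_dvd_pow h1)
    subst hpp
    have : Fact p'.Prime := ⟨hp'⟩
    exact ⟨iterateFrobenius E p' k, fun x => iterateFrobenius_def p' k x⟩
  set ω : E := α ^ nh with hω
  have hω0 : ω ≠ 0 := pow_ne_zero _ hα0
  have hωq1 : ω ^ (q + 1) = 1 := by
    have hqn : q + 1 ∣ n := by
      have h1 : q + 1 ∣ q ^ 2 - 1 := ⟨q - 1, by
        rw [← Nat.sq_sub_sq q 1, one_pow]⟩
      rw [hn, hQ]
      exact h1.trans (by simpa using Nat.sub_dvd_pow_sub_pow (q ^ 2) 1 m)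
    rw [hω, ← pow_mul, ← orderOf_dvd_iff_pow_eq_one, hα, hnh]
    obtain ⟨r, hr⟩ := he
    refine ⟨r, ?_⟩
    rw [hr, ← mul_assoc, Nat.div_mul_cancel ((Dvd.intro r hr.symm).trans hqn)]
  have hωinv : ω⁻¹ ^ q = ω := by
    rw [inv_pow, inv_eq_iff_eq_inv, ← mul_eq_one_iff_eq_inv₀ hω0, ← pow_succ, hωq1]
  have hωQ : ∀ j : ℕ, ω ^ (q ^ 2) ^ j = ω := by
    intro j
    induction j with
    | zero => simp
    | succ j ih =>
      rw [pow_succ (q ^ 2), pow_mul, ih, sq, pow_mul]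
      calc (ω ^ q) ^ q = ((ω ^ q)⁻¹)⁻¹ ^ q := by rw [inv_inv]
        _ = ω := by rw [← inv_pow, hωinv, hωinv]
  set S : Finset ℤ := insert (nh : ℤ)
    (((Finset.Icc 1 (δ - 1)).image fun i : ℕ => (nh : ℤ) + i) ∪
      ((Finset.Icc 1 (δ - 1)).image fun i : ℕ => (nh : ℤ) - q * i)) with hS
  have hzadd : ∀ i : ℕ, α ^ ((nh : ℤ) + i) = ω * α ^ i := fun i => by
    rw [zpow_add₀ hα0, zpow_natCast, zpow_natCast]
  have hzsub : ∀ i : ℕ, α ^ ((nh : ℤ) - q * i) = ω * (α ^ i)⁻¹ ^ q := fun i => by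
    rw [zpow_sub₀ hα0, zpow_natCast, ← Nat.cast_mul, zpow_natCast, mul_comm q i, pow_mul, inv_pow,
      div_eq_mul_inv]
  have hzaddpow : ∀ i j : ℕ,
      (α ^ ((nh : ℤ) + i)) ^ (q ^ 2) ^ j = ω * α ^ (i * (q ^ 2) ^ j) := fun i j => by
    rw [hzadd, mul_pow, hωQ, pow_mul]
  have hzsubpow : ∀ i j : ℕ,
      (α ^ ((nh : ℤ) - q * i)) ^ (q ^ 2) ^ j = ω * (α ^ (i * (q ^ 2) ^ j))⁻¹ ^ q := fun i j => by
    rw [hzsub, mul_pow, hωQ, pow_mul α i, ← inv_pow (α ^ i), pow_right_comm]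
  have hroot : ∀ x : E, aeval x g = 0 ↔ x ∈ rootFinset q m δ α ω := by
    intro x
    rw [mem_rootFinset_iff hE2 hq2 hm, hg, aeval_prod_image_minpoly_eq_zero_iff, hF, hQ, hS]
    simp only [Finset.exists_mem_insert, zpow_natCast, ← hω, hωQ, exists_const, Finset.mem_union,
      Finset.mem_image, or_and_right, exists_or]
    refine or_congr_right ?_
    constructor
    · rintro (⟨_, ⟨i, hi, rfl⟩, j, rfl⟩ | ⟨_, ⟨i, hi, rfl⟩, j, rfl⟩)
      · exact ⟨i, hi, Or.inl ⟨j, hzaddpow i j⟩⟩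
      · exact ⟨i, hi, Or.inr ⟨j, hzsubpow i j⟩⟩
    · rintro ⟨i, hi, ⟨j, rfl⟩ | ⟨j, rfl⟩⟩
      · exact Or.inl ⟨_, ⟨i, hi, rfl⟩, j, (hzaddpow i j).symm⟩
      · exact Or.inr ⟨_, ⟨i, hi, rfl⟩, j, (hzsubpow i j).symm⟩
  have hroot' := fun x => (hroot x).trans (mem_rootFinset_iff hE2 hq2 hm x)
  have hdvd : ∀ f : F[X], (∀ x : E, aeval x g = 0 → aeval x f = 0) → g ∣ f := by
    intro f hf
    rw [hg, prod_image_minpoly_dvd_iff]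
    refine fun s hs => hf _ ?_
    rw [hg, aeval_prod_image_minpoly_eq_zero_iff]
    exact ⟨s, hs, 0, by simp⟩
  have hgX : g ∣ X ^ n - 1 := by
    rw [hg, prod_image_minpoly_dvd_iff]
    intro s _
    rw [map_sub, map_pow, aeval_X, map_one, sub_eq_zero, hnE]
    exact FiniteField.pow_card_sub_one_eq_one _ (zpow_ne_zero _ hα0)
  have hX0 : (X ^ n - 1 : F[X]) ≠ 0 := (monic_X_pow_sub_C (1 : F) hn0.ne').ne_zero
  have hg0 : g ≠ 0 := ne_zero_of_dvd_ne_zero hX0 hgX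
  have hgdeg : g.natDegree ≤ n :=
    (natDegree_le_of_dvd hgX hX0).trans (natDegree_X_pow_sub_C (r := (1 : F))).le
  have hgzero : aeval (0 : E) g ≠ 0 := by
    intro h
    obtain ⟨r, hr⟩ := hgX
    have h1 := congrArg (aeval (0 : E)) hr
    simp [h, hn0.ne'] at h1
  refine ⟨isHermitianLCD_of_root_stable φ hφ hnE hdvd hgzero ?_, ?_, ?_⟩
  · intro x hx
    rw [hroot'] at hx ⊢
    rcases hx with rfl | ⟨i, hi, j, rfl | rfl⟩
    · exact Or.inl hωinv
    · refine Or.inr ⟨i, hi, j, Or.inr ?_⟩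
      rw [mul_inv, mul_pow, hωinv]
    · refine Or.inr ⟨i, hi, j + 1, Or.inl ?_⟩
      rw [mul_inv, mul_pow, hωinv]
      simp only [inv_pow, inv_inv, ← pow_mul]
      ring_nf
  · have hsep : (X ^ n - 1 : F[X]).Separable := by
      refine X_pow_sub_one_separable_iff.2 fun h => ?_
      have h1 : ((n + 1 : ℕ) : F) = 0 := by
        rw [hn, Nat.sub_add_cancel (by rw [← hE]; omega), ← hF, Nat.cast_pow,
          Nat.cast_card_eq_zero, zero_pow (by omega)]
      rw [Nat.cast_add, h] at h1
      simp at h1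
    have hsplit : (g.map (algebraMap F E)).Splits := by
      refine (X_pow_sub_one_splits (hα ▸ IsPrimitiveRoot.orderOf α)).of_dvd
        (monic_X_pow_sub_C (1 : E) hn0.ne').ne_zero ?_
      simpa using Polynomial.map_dvd (algebraMap F E) hgX
    have hdeg := card_rootSet_eq_natDegree (hsep.of_dvd hgX) hsplit
    have hset : g.rootSet E = (rootFinset q m δ α ω : Set E) := by
      ext x
      rw [mem_rootSet_of_ne hg0, hroot, Finset.mem_coe]
    rw [← Nat.card_eq_fintype_card, hset, Nat.card_coe_set_eq, Set.ncard_coe_finset,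
      card_rootFinset hnq hα hq2 hm hme hδ2 hα0 hω0 φ hφ, ← hQ] at hdeg
    have hfin := finrank_cyclicCodeOf_add_natDegree hg0 hgdeg
    rw [← hdeg] at hfin
    have hnQ : ((n : ℕ) : ℤ) = (Q : ℤ) ^ m - 1 := by
      rw [hn, Nat.cast_sub (by rw [← hE]; omega)]
      simp
    have hfin' := congrArg (Nat.cast : ℕ → ℤ) hfin
    rw [hnQ, Nat.cast_add, Nat.cast_add, Nat.cast_mul, Nat.cast_mul] at hfin'
    push_cast at hfin' ⊢
    linarith
  · intro c hc hc0
    have hu : q * ((δ - 1) / q) ≤ δ - 1 := Nat.mul_div_le _ _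
    have hlt : δ + (δ - 1) / q < hammingNorm c := by
      refine lt_hammingNorm_of_consecutive_roots (b := (nh : ℤ) - ((δ - 1) / q : ℕ)) hα hc0 ?_
      intro l hl
      obtain ⟨r, hr⟩ := mem_cyclicCodeOf.1 hc
      rw [hr, map_mul, mul_eq_zero]
      refine Or.inl ((hroot' _).2 ?_)
      rcases lt_trichotomy l ((δ - 1) / q) with h | h | h
      · obtain ⟨v, hv⟩ : ∃ v, v = (δ - 1) / q - l := ⟨_, rfl⟩
        have hv1 : q * v ≤ q * ((δ - 1) / q) := Nat.mul_le_mul_left _ (by omega)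
        have hv0 : 0 < q * v := Nat.mul_pos (by omega) (by omega)
        refine Or.inr ⟨q * v, Finset.mem_Icc.2 ⟨hv0, by omega⟩, m - 1, Or.inr ?_⟩
        rw [show (nh : ℤ) - ((δ - 1) / q : ℕ) + l = (nh : ℤ) - (v : ℕ) by omega, zpow_sub₀ hα0,
          zpow_natCast, zpow_natCast, inv_pow, ← pow_mul, div_eq_mul_inv]
        have hexp : q * v * (q ^ 2) ^ (m - 1) * q = v * Fintype.card E := by
          rw [hE2]
          obtain ⟨k, rfl⟩ : ∃ k, m = k + 1 := ⟨m - 1, by omega⟩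
          rw [Nat.add_sub_cancel]
          ring
        rw [hexp, pow_mul, FiniteField.pow_card]
      · left
        rw [h, sub_add_cancel, zpow_natCast]
      · refine Or.inr ⟨l - (δ - 1) / q, Finset.mem_Icc.2 (by omega), 0, Or.inl ?_⟩
        rw [pow_zero, mul_one, ← hzadd]
        congr 1
        omega
    omega
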